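/- Arveson's order isomorphism: For a completely positive map T : X → B(H) with minimal Stinespring representation (π_T, K_T, V_T), the map R ↦ V_T*(R π_T(·))V_T is an affine order isomorphism from {R ∈ π_T(X)′ : 0 ≤ R ≤ 1} onto the order interval [0,T] = {T′ CP : 0 ≤ T′ ≤ T}. -/

import Mathlib

open scoped ComplexOrder InnerProductSpace

noncomputable section

/-- A matrix over a star ring is positive if it is of the form `Nᴴ * N`. -/
def MatPos {A : Type*} [Ring A] [StarRing A] {n : ℕ}
    (M : Matrix (Fin n) (Fin n) A) : Prop :=
  ∃ N : Matrix (Fin n) (Fin n) A, M = N.conjTranspose * N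

/-- `T` is completely positive if the induced entrywise maps on matrices are positive. -/
def CompletelyPositiveFun {A B : Type*} [Ring A] [StarRing A] [Ring B] [StarRing B]
    (T : A → B) : Prop :=
  ∀ (n : ℕ) (M : Matrix (Fin n) (Fin n) A), MatPos M → MatPos (M.map T)

/-- `(π, K, V)` is a Stinespring representation of `T : X → B(H)`:
`T x = V* (π x) V` for all `x`. -/
def IsStinespring {X : Type*} [NormedRing X] [StarRing X] [CStarRing X]
    [NormedAlgebra ℂ X] [StarModule ℂ X]
    {H K : Type*} [NormedAddCommGroup H] [InnerProductSpace ℂ H] [CompleteSpace H]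
    [NormedAddCommGroup K] [InnerProductSpace ℂ K] [CompleteSpace K]
    (T : X → (H →L[ℂ] H)) (π : X →⋆ₐ[ℂ] (K →L[ℂ] K)) (V : H →L[ℂ] K) : Prop :=
  ∀ x : X, T x = (ContinuousLinearMap.adjoint V).comp ((π x).comp V)

/-- Minimality: the closed linear span of `π(X) V H` is all of `K`. -/
def IsMinimalStinespring {X : Type*} [NormedRing X] [StarRing X] [CStarRing X]
    [NormedAlgebra ℂ X] [StarModule ℂ X]
    {H K : Type*} [NormedAddCommGroup H] [InnerProductSpace ℂ H] [CompleteSpace H]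
    [NormedAddCommGroup K] [InnerProductSpace ℂ K] [CompleteSpace K]
    (π : X →⋆ₐ[ℂ] (K →L[ℂ] K)) (V : H →L[ℂ] K) : Prop :=
  (Submodule.span ℂ {k : K | ∃ (x : X) (h : H), k = π x (V h)}).topologicalClosure = ⊤

section Arveson

variable {X : Type*} [NormedRing X] [StarRing X] [CStarRing X]
    [NormedAlgebra ℂ X] [StarModule ℂ X]
    {H K : Type*} [NormedAddCommGroup H] [InnerProductSpace ℂ H] [CompleteSpace H]
    [NormedAddCommGroup K] [InnerProductSpace ℂ K] [CompleteSpace K]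

/-- The compression map `R ↦ V* (R π(·)) V`. -/
def compress (π : X →⋆ₐ[ℂ] (K →L[ℂ] K)) (V : H →L[ℂ] K)
    (R : K →L[ℂ] K) : X → (H →L[ℂ] H) :=
  fun x => (ContinuousLinearMap.adjoint V).comp (R.comp ((π x).comp V))

/-- `R` lies in the commutant of `π(X)` and satisfies `0 ≤ R ≤ 1`. -/
def InCommutantUnitInterval (π : X →⋆ₐ[ℂ] (K →L[ℂ] K)) (R : K →L[ℂ] K) : Prop :=
  (∀ x : X, R * π x = π x * R) ∧ R.IsPositive ∧ (1 - R).IsPositive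

theorem isPositive_of_inner_nonneg {E : Type*} [NormedAddCommGroup E] [InnerProductSpace ℂ E]
    {R : E →L[ℂ] E} (h : ∀ k, 0 ≤ ⟪k, R k⟫_ℂ) : R.IsPositive := by
  rw [ContinuousLinearMap.isPositive_iff_complex]
  intro k
  obtain ⟨h1, h2⟩ := Complex.nonneg_iff.mp (h k)
  have h3 : (⟪R k, k⟫_ℂ).re = (⟪k, R k⟫_ℂ).re := inner_re_symm (𝕜 := ℂ) _ _
  have h4 : (⟪R k, k⟫_ℂ).im = -(⟪k, R k⟫_ℂ).im := inner_im_symm (𝕜 := ℂ) _ _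
  exact ⟨Complex.ext rfl (by simp [h4, ← h2]), h1.trans_eq h3.symm⟩

theorem ContinuousLinearMap.IsPositive.exists_eq_star_mul_self {E : Type*} [NormedAddCommGroup E]
    [InnerProductSpace ℂ E] [CompleteSpace E] {R : E →L[ℂ] E} (h : R.IsPositive) :
    ∃ S : E →L[ℂ] E, R = star S * S :=
  CStarAlgebra.nonneg_iff_eq_star_mul_self.mp ((ContinuousLinearMap.nonneg_iff_isPositive R).mpr h)

/-- A matrix of operators has the form `Nᴴ * N` as soon as its quadratic form is nonnegative. -/
theorem matPos_of_sum_inner_nonneg {n : ℕ} {M : Matrix (Fin n) (Fin n) (H →L[ℂ] H)}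
    (hM : ∀ u : Fin n → H, 0 ≤ ∑ i, ∑ j, ⟪u i, M i j (u j)⟫_ℂ) : MatPos M := by
  let p (i : Fin n) : PiLp 2 (fun _ : Fin n => H) →L[ℂ] H := PiLp.proj 2 (fun _ : Fin n => H) i
  have hp (i j : Fin n) (h : H) : (p j).adjoint h i = if i = j then h else 0 := by
    refine ext_inner_left ℂ fun g => ?_
    have := (p j).adjoint_inner_right (PiLp.single 2 i g) h
    have h1 (v : PiLp 2 fun _ : Fin n => H) :
        ⟪PiLp.single 2 i g, v⟫_ℂ = ⟪g, v i⟫_ℂ := by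
      rw [PiLp.inner_apply, Finset.sum_eq_single i] <;>
        simp +contextual
    rw [← h1, this]
    by_cases hij : i = j
    · simp [p, hij]
    · simp [p, hij, Ne.symm hij]
  let P : PiLp 2 (fun _ : Fin n => H) →L[ℂ] PiLp 2 (fun _ : Fin n => H) :=
    ∑ i, ∑ j, (p i).adjoint ∘L M i j ∘L p j
  have hP (u v) : ⟪u, P v⟫_ℂ = ∑ i, ∑ j, ⟪u i, M i j (v j)⟫_ℂ := by
    simp [P, ContinuousLinearMap.adjoint_inner_right, p]
  have hPpos : P.IsPositive := by
    exact isPositive_of_inner_nonneg fun u => (hP u u).symm ▸ hM u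
  obtain ⟨S, hS⟩ := hPpos.exists_eq_star_mul_self
  refine ⟨Matrix.of fun k j => p k ∘L S ∘L (p j).adjoint, ?_⟩
  ext i j h
  refine ext_inner_left ℂ fun g => ?_
  have h1 : ⟪(p i).adjoint g, P ((p j).adjoint h)⟫_ℂ = ⟪g, M i j h⟫_ℂ := by
    rw [hP]
    rw [Finset.sum_eq_single i, Finset.sum_eq_single j] <;> simp +contextual [hp]
  have h2 : ⟪(p i).adjoint g, P ((p j).adjoint h)⟫_ℂ =
      ⟪S ((p i).adjoint g), S ((p j).adjoint h)⟫_ℂ := by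
    rw [hS, ContinuousLinearMap.star_eq_adjoint, mul_apply_eq_comp,
      ContinuousLinearMap.adjoint_inner_right]
  rw [← h1, h2, PiLp.inner_apply, Matrix.mul_apply]
  simp only [_root_.sum_apply, inner_sum]
  refine Finset.sum_congr rfl fun k _ => ?_
  rw [mul_apply_eq_comp, Matrix.conjTranspose_apply, ContinuousLinearMap.star_eq_adjoint,
    ContinuousLinearMap.adjoint_inner_right]
  rfl

theorem MatPos.sum_inner_nonneg {n : ℕ} {M : Matrix (Fin n) (Fin n) (H →L[ℂ] H)}
    (hM : MatPos M) (u : Fin n → H) : 0 ≤ ∑ i, ∑ j, ⟪u i, M i j (u j)⟫_ℂ := by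
  obtain ⟨N, rfl⟩ := hM
  have : ∑ i, ∑ j, ⟪u i, (N.conjTranspose * N) i j (u j)⟫_ℂ =
      ∑ k, ⟪∑ i, N k i (u i), ∑ j, N k j (u j)⟫_ℂ := by
    simp only [Matrix.mul_apply, Matrix.conjTranspose_apply, ContinuousLinearMap.star_eq_adjoint,
      _root_.sum_apply, mul_apply_eq_comp, inner_sum, sum_inner,
      ContinuousLinearMap.adjoint_inner_right]
    rw [Finset.sum_comm_cycle]
    refine Finset.sum_congr rfl fun k _ => Finset.sum_comm
  rw [this]
  exact Finset.sum_nonneg fun k _ => by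
    rw [inner_self_eq_norm_sq_to_K]
    positivity

theorem MatPos.conjTranspose_eq {A : Type*} [Ring A] [StarRing A] {n : ℕ}
    {M : Matrix (Fin n) (Fin n) A} (hM : MatPos M) : M.conjTranspose = M := by
  obtain ⟨N, rfl⟩ := hM
  simp [Matrix.conjTranspose_mul]

/-- The matrix `(star (x i) * x j)` is positive. -/
theorem matPos_star_mul {A : Type*} [Ring A] [StarRing A] {n : ℕ} (x : Fin n → A) :
    MatPos (Matrix.of fun i j => star (x i) * x j) := by
  cases n with
  | zero => exact ⟨0, by ext i; exact i.elim0⟩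
  | succ n =>
    refine ⟨Matrix.of fun i j => if i = 0 then x j else 0, ?_⟩
    ext i j
    simp [Matrix.mul_apply]

theorem CompletelyPositiveFun.map_star {A B : Type*} [Ring A] [StarRing A] [Ring B] [StarRing B]
    {T : A → B} (hT : CompletelyPositiveFun T) (a : A) : T (star a) = star (T a) := by
  have := congr_fun₂ (hT 2 _ (matPos_star_mul ![1, a])).conjTranspose_eq 1 0
  simpa using this.symm

/-- The sesquilinear form on finitely supported functions `X →₀ H` induced by `T : X → B(H)`. -/
def kernelForm (T : X → (H →L[ℂ] H)) (f g : X →₀ H) : ℂ :=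
  f.sum fun x h => g.sum fun y k => ⟪h, T (star x * y) k⟫_ℂ

omit [CStarRing X] [NormedAlgebra ℂ X] [StarModule ℂ X] in
theorem CompletelyPositiveFun.kernelForm_self_nonneg {T : X → (H →L[ℂ] H)}
    (hT : CompletelyPositiveFun T) (f : X →₀ H) : 0 ≤ kernelForm T f f := by
  let e := f.support.equivFin.symm
  have h := (hT _ _ (matPos_star_mul fun i => (e i : X))).sum_inner_nonneg fun i => f (e i)
  have key : ∑ i, ∑ j, ⟪f (e i), T (star (e i : X) * e j) (f (e j))⟫_ℂ = kernelForm T f f := by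
    unfold kernelForm Finsupp.sum
    rw [← Finset.sum_coe_sort f.support, ← Equiv.sum_comp e]
    refine Finset.sum_congr rfl fun i _ => ?_
    dsimp only
    rw [← Finset.sum_coe_sort f.support, ← Equiv.sum_comp e]
  rw [← key]
  exact h

/-- The inner product core on `X →₀ H` induced by a completely positive map. -/
@[reducible]
def kernelCore (T : X →ₗ[ℂ] (H →L[ℂ] H)) (hT : CompletelyPositiveFun (⇑T)) :
    PreInnerProductSpace.Core ℂ (X →₀ H) where
  inner := kernelForm T
  conj_inner_symm f g := by
    simp only [kernelForm, Finsupp.sum, map_sum, inner_conj_symm]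
    rw [Finset.sum_comm]
    refine Finset.sum_congr rfl fun x _ => Finset.sum_congr rfl fun y _ => ?_
    rw [← ContinuousLinearMap.adjoint_inner_right, ← ContinuousLinearMap.star_eq_adjoint,
      ← hT.map_star]
    simp
  re_inner_nonneg f := (Complex.nonneg_iff.mp (hT.kernelForm_self_nonneg f)).1
  add_left f g k := by
    refine Finsupp.sum_add_index' ?_ ?_ <;> simp [Finsupp.sum_add]
  smul_left f g r := by
    unfold kernelForm
    rw [Finsupp.sum_smul_index' (by simp)]
    simp only [inner_smul_left, Finsupp.sum, Finset.mul_sum]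

/-- The linear map `X →₀ H → K` sending `single x h` to `π x (V h)`. -/
def stinespringMap (π : X →⋆ₐ[ℂ] (K →L[ℂ] K)) (V : H →L[ℂ] K) : (X →₀ H) →ₗ[ℂ] K :=
  Finsupp.lsum ℂ fun x => ((π x).comp V).toLinearMap

omit [CStarRing X] [StarModule ℂ X] [CompleteSpace H] in
@[simp]
theorem stinespringMap_single (π : X →⋆ₐ[ℂ] (K →L[ℂ] K)) (V : H →L[ℂ] K) (x : X) (h : H) :
    stinespringMap π V (Finsupp.single x h) = π x (V h) := by
  simp [stinespringMap]

theorem IsMinimalStinespring.denseRange {π : X →⋆ₐ[ℂ] (K →L[ℂ] K)} {V : H →L[ℂ] K}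
    (hmin : IsMinimalStinespring π V) : DenseRange (stinespringMap π V) := by
  have h : Submodule.span ℂ {k : K | ∃ (x : X) (h : H), k = π x (V h)} ≤
      LinearMap.range (stinespringMap π V) := by
    rw [Submodule.span_le]
    rintro _ ⟨x, h, rfl⟩
    exact ⟨Finsupp.single x h, by simp⟩
  have h' := (Submodule.dense_iff_topologicalClosure_eq_top.mpr hmin).mono h
  simpa only [DenseRange, LinearMap.coe_range] using h'

/-- Two continuous operators agree if their matrix coefficients agree on the vectors `π x (V h)`. -/
theorem IsMinimalStinespring.ext_inner {π : X →⋆ₐ[ℂ] (K →L[ℂ] K)} {V : H →L[ℂ] K}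
    (hmin : IsMinimalStinespring π V) {R S : K →L[ℂ] K}
    (h : ∀ x y a b, ⟪π x (V a), R (π y (V b))⟫_ℂ = ⟪π x (V a), S (π y (V b))⟫_ℂ) : R = S := by
  have hlin : R.toLinearMap ∘ₗ stinespringMap π V = S.toLinearMap ∘ₗ stinespringMap π V := by
    ext y b
    refine hmin.denseRange.eq_of_inner_right ℂ fun f => ?_
    simp only [LinearMap.comp_apply, Finsupp.lsingle_apply, stinespringMap_single]
    simp [stinespringMap, Finsupp.sum, sum_inner, h]
  exact ContinuousLinearMap.coeFn_injective
    (hmin.denseRange.equalizer R.continuous S.continuous (congr_arg DFunLike.coe hlin))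

omit [CStarRing X] [StarModule ℂ X] in
theorem compress_star_mul {π : X →⋆ₐ[ℂ] (K →L[ℂ] K)} (V : H →L[ℂ] K) {R : K →L[ℂ] K}
    (hR : ∀ x, R * π x = π x * R) (x y : X) (a b : H) :
    ⟪a, compress π V R (star x * y) b⟫_ℂ = ⟪π x (V a), R (π y (V b))⟫_ℂ := by
  have h (k : K) : R (π (star x) k) = π (star x) (R k) := DFunLike.congr_fun (hR (star x)) k
  simp only [compress, ContinuousLinearMap.comp_apply, map_mul, mul_apply_eq_comp, h,
    ContinuousLinearMap.adjoint_inner_right]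
  rw [map_star, ContinuousLinearMap.star_eq_adjoint,
    ContinuousLinearMap.adjoint_inner_right]

omit [CStarRing X] [StarModule ℂ X] in
theorem kernelForm_compress {π : X →⋆ₐ[ℂ] (K →L[ℂ] K)} (V : H →L[ℂ] K) {R : K →L[ℂ] K}
    (hR : ∀ x, R * π x = π x * R) (f g : X →₀ H) :
    kernelForm (compress π V R) f g = ⟪stinespringMap π V f, R (stinespringMap π V g)⟫_ℂ := by
  simp only [kernelForm, compress_star_mul V hR, stinespringMap, Finsupp.lsum_apply, Finsupp.sum,
    map_sum, inner_sum, sum_inner]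
  rw [Finset.sum_comm]
  rfl

omit [CStarRing X] [StarModule ℂ X] in
theorem completelyPositiveFun_compress {π : X →⋆ₐ[ℂ] (K →L[ℂ] K)} (V : H →L[ℂ] K)
    {R : K →L[ℂ] K} (hR : ∀ x, R * π x = π x * R) (hpos : R.IsPositive) :
    CompletelyPositiveFun (compress π V R) := by
  rintro n _ ⟨N, rfl⟩
  refine matPos_of_sum_inner_nonneg fun u => ?_
  have : ∑ i, ∑ j, ⟪u i, (N.conjTranspose * N).map (compress π V R) i j (u j)⟫_ℂ =
      ∑ k, ⟪∑ i, π (N k i) (V (u i)), R (∑ j, π (N k j) (V (u j)))⟫_ℂ := by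
    have hsum (i j : Fin n) : compress π V R ((N.conjTranspose * N) i j) =
        ∑ k, compress π V R (star (N k i) * N k j) := by
      ext h
      simp [Matrix.mul_apply, compress]
    simp only [Matrix.map_apply, hsum, _root_.sum_apply, inner_sum, sum_inner,
      map_sum, compress_star_mul V hR]
    rw [Finset.sum_comm_cycle]
    refine Finset.sum_congr rfl fun k _ => Finset.sum_comm
  rw [this]
  exact Finset.sum_nonneg fun k _ => hpos.inner_nonneg_right _

theorem IsMinimalStinespring.isPositive_of_completelyPositiveFun
    {π : X →⋆ₐ[ℂ] (K →L[ℂ] K)} {V : H →L[ℂ] K} (hmin : IsMinimalStinespring π V)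
    {R : K →L[ℂ] K} (hR : ∀ x, R * π x = π x * R)
    (hcp : CompletelyPositiveFun (compress π V R)) : R.IsPositive := by
  have hnonneg (k : K) : 0 ≤ ⟪k, R k⟫_ℂ := by
    refine hmin.denseRange.induction_on k (isClosed_le (by fun_prop) (by fun_prop)) fun f => ?_
    rw [← kernelForm_compress V hR]
    exact hcp.kernelForm_self_nonneg f
  exact isPositive_of_inner_nonneg hnonneg

/-- A semi-inner product on `F` dominated by the one pulled back along a map `q : F → K` with
dense range is represented by an operator `0 ≤ R ≤ 1` on `K`. -/
theorem exists_isPositive_of_core_le {F : Type*} [AddCommGroup F] [Module ℂ F]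
    (c : PreInnerProductSpace.Core ℂ F) (q : F →ₗ[ℂ] K) (hq : DenseRange q)
    (hle : ∀ f, (c.inner f f).re ≤ ‖q f‖ ^ 2) :
    ∃ R : K →L[ℂ] K, R.IsPositive ∧ (1 - R).IsPositive ∧
      ∀ f g, ⟪q f, R (q g)⟫_ℂ = c.inner f g := by
  let _ : SeminormedAddCommGroup F := @InnerProductSpace.Core.toSeminormedAddCommGroup ℂ F _ _ _ c
  let _ : InnerProductSpace ℂ F := InnerProductSpace.ofCore c
  let j : F →ₗ[ℂ] UniformSpace.Completion F :=
    (UniformSpace.Completion.toComplL (𝕜 := ℂ) (E := F)).toLinearMap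
  have hj (f g : F) : ⟪j f, j g⟫_ℂ = c.inner f g := UniformSpace.Completion.inner_coe f g
  have hbound (f : F) : ‖j f‖ ≤ 1 * ‖q f‖ := by
    rw [one_mul]
    refine (sq_le_sq₀ (norm_nonneg _) (norm_nonneg _)).mp ?_
    rw [← inner_self_eq_norm_sq (𝕜 := ℂ), hj]
    exact hle f
  let C : K →L[ℂ] UniformSpace.Completion F := j.extendOfNorm q
  have hC (f : F) : C (q f) = j f := LinearMap.extendOfNorm_eq hq ⟨1, hbound⟩ f
  have hCle (k : K) : ‖C k‖ ≤ 1 * ‖k‖ := LinearMap.norm_extendOfNorm_apply_le hq 1 hbound k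
  refine ⟨C.adjoint ∘L C, ContinuousLinearMap.isPositive_adjoint_comp_self C, ?_, fun f g => ?_⟩
  · refine isPositive_of_inner_nonneg fun k => ?_
    rw [_root_.sub_apply, inner_sub_right, ContinuousLinearMap.comp_apply,
      ContinuousLinearMap.adjoint_inner_right, one_apply_eq_self,
      inner_self_eq_norm_sq_to_K, inner_self_eq_norm_sq_to_K, sub_nonneg]
    have := hCle k
    rw [one_mul] at this
    exact_mod_cast pow_le_pow_left₀ (norm_nonneg _) this 2
  · rw [ContinuousLinearMap.comp_apply, ContinuousLinearMap.adjoint_inner_right, hC, hC, hj]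

omit [CStarRing X] [StarModule ℂ X] in
theorem compress_sub (π : X →⋆ₐ[ℂ] (K →L[ℂ] K)) (V : H →L[ℂ] K) (R S : K →L[ℂ] K) :
    compress π V (R - S) = fun x => compress π V R x - compress π V S x := by
  ext x h
  simp [compress]

/-- Arveson's order isomorphism: for a CP map `T : X → B(H)` with minimal Stinespring
representation `(π, K, V)`, the map `R ↦ V*(R π(·))V` is an affine order isomorphism
from `{R ∈ π(X)′ : 0 ≤ R ≤ 1}` onto the order interval `[0, T]` of CP maps. -/
theorem arveson_order_isomorphism
    (T : X →ₗ[ℂ] (H →L[ℂ] H)) (hT : CompletelyPositiveFun (⇑T))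
    (π : X →⋆ₐ[ℂ] (K →L[ℂ] K)) (V : H →L[ℂ] K)
    (hst : IsStinespring (⇑T) π V) (hmin : IsMinimalStinespring π V) :
    -- maps into the order interval `[0, T]`
    (∀ R : K →L[ℂ] K, InCommutantUnitInterval π R →
        CompletelyPositiveFun (compress π V R) ∧
        CompletelyPositiveFun (fun x => T x - compress π V R x)) ∧
    -- injective
    (∀ R R' : K →L[ℂ] K, InCommutantUnitInterval π R → InCommutantUnitInterval π R' →
        compress π V R = compress π V R' → R = R') ∧
    -- surjective onto `[0, T]`
    (∀ T' : X →ₗ[ℂ] (H →L[ℂ] H), CompletelyPositiveFun (⇑T') →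
        CompletelyPositiveFun (fun x => T x - T' x) →
        ∃ R : K →L[ℂ] K, InCommutantUnitInterval π R ∧ compress π V R = ⇑T') ∧
    -- affine
    (∀ R R' : K →L[ℂ] K, InCommutantUnitInterval π R → InCommutantUnitInterval π R' →
        ∀ c : ℝ, 0 ≤ c → c ≤ 1 →
        compress π V ((c : ℂ) • R + ((1 - c : ℝ) : ℂ) • R') =
          fun x => (c : ℂ) • compress π V R x + ((1 - c : ℝ) : ℂ) • compress π V R' x) ∧
    -- order isomorphism
    (∀ R R' : K →L[ℂ] K, InCommutantUnitInterval π R → InCommutantUnitInterval π R' →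
        ((R' - R).IsPositive ↔
          CompletelyPositiveFun (fun x => compress π V R' x - compress π V R x))) := by
  have hT1 : (⇑T : X → (H →L[ℂ] H)) = compress π V 1 := by
    ext1 x
    rw [hst x]
    rfl
  have hcomm {R R' : K →L[ℂ] K} (h : ∀ x, R * π x = π x * R) (h' : ∀ x, R' * π x = π x * R')
      (x : X) : (R - R') * π x = π x * (R - R') := by
    rw [sub_mul, mul_sub, h, h']
  have hone (x : X) : (1 : K →L[ℂ] K) * π x = π x * 1 := by simp
  refine ⟨fun R hR => ⟨completelyPositiveFun_compress V hR.1 hR.2.1, ?_⟩, fun R R' hR hR' h => ?_,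
    fun T' hT' hTT' => ?_, fun R R' _ _ c _ _ => ?_, fun R R' hR hR' => ⟨fun h => ?_, fun h => ?_⟩⟩
  · rw [hT1, ← compress_sub]
    exact completelyPositiveFun_compress V (hcomm hone hR.1) hR.2.2
  · refine hmin.ext_inner fun x y a b => ?_
    rw [← compress_star_mul V hR.1, ← compress_star_mul V hR'.1, h]
  · have hle (f : X →₀ H) : (kernelForm T' f f).re ≤ ‖stinespringMap π V f‖ ^ 2 := by
      have h1 := (Complex.nonneg_iff.mp (hTT'.kernelForm_self_nonneg f)).1
      have h2 : kernelForm (fun x => T x - T' x) f f = kernelForm T f f - kernelForm T' f f := by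
        simp [kernelForm, Finsupp.sum, Finset.sum_sub_distrib]
      have h3 : kernelForm T f f = (‖stinespringMap π V f‖ : ℂ) ^ 2 := by
        rw [hT1, kernelForm_compress V hone]
        exact inner_self_eq_norm_sq_to_K _
      rw [h2, h3, Complex.sub_re] at h1
      norm_cast at h1
      linarith
    obtain ⟨R, hpos, hpos', hR⟩ :=
      exists_isPositive_of_core_le (kernelCore T' hT') (stinespringMap π V) hmin.denseRange hle
    have hR' (x y : X) (a b : H) :
        ⟪π x (V a), R (π y (V b))⟫_ℂ = ⟪a, T' (star x * y) b⟫_ℂ := by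
      have := hR (Finsupp.single x a) (Finsupp.single y b)
      rw [stinespringMap_single, stinespringMap_single] at this
      rw [this]
      change kernelForm T' _ _ = _
      simp [kernelForm]
    refine ⟨R, ⟨fun z => hmin.ext_inner fun x y a b => ?_, hpos, hpos'⟩, ?_⟩
    · have h1 : π z (π y (V b)) = π (z * y) (V b) := by simp
      have h2 : π (star z) (π x (V a)) = π (star z * x) (V a) := by simp
      rw [mul_apply_eq_comp, mul_apply_eq_comp, h1, hR',
        ← ContinuousLinearMap.adjoint_inner_left (π z), ← ContinuousLinearMap.star_eq_adjoint,
        ← map_star π, h2, hR']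
      simp [mul_assoc]
    · ext x b
      refine ext_inner_left ℂ fun a => ?_
      have := hR' 1 x a b
      simpa [compress, ContinuousLinearMap.adjoint_inner_right] using this
  · ext x h
    simp [compress]
  · rw [← compress_sub]
    exact completelyPositiveFun_compress V (hcomm hR'.1 hR.1) h
  · rw [← compress_sub] at h
    exact hmin.isPositive_of_completelyPositiveFun (hcomm hR'.1 hR.1) h

end Arveson
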